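/- arXiv:1508.02068 — 2 statements merged into one kernel-verified Lean document; each statement's English description precedes it below -/
import Mathlib

section
/- Let H₀, H₁, …, H_m ∈ ℂ^{n×n} be Hermitian and h₁, …, h_m ∈ ℝ. Then the following three optimal values coincide (as infima in ℝ ∪ {±∞}): (i) val(SDP-ℂ) := inf{ Tr(H₀ Z) : Z ∈ ℂ^{n×n} Hermitian positive semidefinite, Tr(H_i Z) ≤ h_i for i = 1,…,m }; (ii) val(CSDP-ℝ) := inf{ Tr(Λ(H₀) X) : X ∈ S_{2n} positive semidefinite, Tr(Λ(H_i) X) ≤ h_i for i = 1,…,m, and X = [[A, Bᵀ],[B, C]] with A = C and Bᵀ = −B }; (iii) val(SDP-ℝ) := inf{ Tr(Λ(H₀) X) : X ∈ S_{2n} positive semidefinite, Tr(Λ(H_i) X) ≤ h_i for i = 1,…,m }. -/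
open scoped ComplexOrder
open Matrix

noncomputable section

/-- The ring homomorphism `Λ` sending a complex matrix `Z` to the real matrix
`[[Re Z, −Im Z],[Im Z, Re Z]]`. -/
def Lam {n : ℕ} (Z : Matrix (Fin n) (Fin n) ℂ) :
    Matrix (Fin n ⊕ Fin n) (Fin n ⊕ Fin n) ℝ :=
  Matrix.fromBlocks (Z.map Complex.re) (-(Z.map Complex.im))
    (Z.map Complex.im) (Z.map Complex.re)

/-- Optimal value of SDP-ℂ. -/
def valSDPC (n m : ℕ) (H0 : Matrix (Fin n) (Fin n) ℂ)
    (H : Fin m → Matrix (Fin n) (Fin n) ℂ) (h : Fin m → ℝ) : EReal :=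
  sInf {x : EReal | ∃ Z : Matrix (Fin n) (Fin n) ℂ, Z.PosSemidef ∧
    (∀ i, ((H i * Z).trace).re ≤ h i) ∧ x = ((((H0 * Z).trace).re : ℝ) : EReal)}

/-- The extra block structure constraint of CSDP-ℝ:
`X = [[A, Bᵀ],[B, C]]` with `A = C` and `Bᵀ = −B`. -/
def CBlock (n : ℕ) (X : Matrix (Fin n ⊕ Fin n) (Fin n ⊕ Fin n) ℝ) : Prop :=
  ∃ A B C : Matrix (Fin n) (Fin n) ℝ,
    X = Matrix.fromBlocks A Bᵀ B C ∧ A = C ∧ Bᵀ = -B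

/-- Optimal value of CSDP-ℝ. -/
def valCSDPR (n m : ℕ) (H0 : Matrix (Fin n) (Fin n) ℂ)
    (H : Fin m → Matrix (Fin n) (Fin n) ℂ) (h : Fin m → ℝ) : EReal :=
  sInf {x : EReal | ∃ X : Matrix (Fin n ⊕ Fin n) (Fin n ⊕ Fin n) ℝ,
    X.IsSymm ∧ X.PosSemidef ∧ (∀ i, (Lam (H i) * X).trace ≤ h i) ∧ CBlock n X ∧
    x = (((Lam H0 * X).trace : ℝ) : EReal)}

/-- Optimal value of SDP-ℝ. -/
def valSDPR (n m : ℕ) (H0 : Matrix (Fin n) (Fin n) ℂ)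
    (H : Fin m → Matrix (Fin n) (Fin n) ℂ) (h : Fin m → ℝ) : EReal :=
  sInf {x : EReal | ∃ X : Matrix (Fin n ⊕ Fin n) (Fin n ⊕ Fin n) ℝ,
    X.IsSymm ∧ X.PosSemidef ∧ (∀ i, (Lam (H i) * X).trace ≤ h i) ∧
    x = (((Lam H0 * X).trace : ℝ) : EReal)}

open scoped MatrixOrder Matrix.Norms.L2Operator in
theorem psd_factor {𝕜 ι : Type*} [RCLike 𝕜] [Fintype ι] [DecidableEq ι] {A : Matrix ι ι 𝕜}
    (hA : A.PosSemidef) : ∃ Y : Matrix ι ι 𝕜, A = Yᴴ * Y :=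
  CStarAlgebra.nonneg_iff_eq_star_mul_self.mp hA.nonneg

theorem Lam_psd {n : ℕ} {Z : Matrix (Fin n) (Fin n) ℂ} (hZ : Z.PosSemidef) :
    (Lam Z).PosSemidef := by
  classical
  obtain ⟨Y, rfl⟩ := psd_factor hZ
  have : Lam (Yᴴ * Y) = (Lam Y)ᴴ * Lam Y := by
    ext (i | i) (j | j) <;>
      simp [Lam, Matrix.mul_apply, Fintype.sum_sum_type, ← Finset.sum_add_distrib,
        ← Finset.sum_neg_distrib] <;>
      (try apply Finset.sum_congr rfl) <;> intros <;> ring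
  rw [this]
  exact Matrix.posSemidef_conjTranspose_mul_self _

def toC {n : ℕ} (X : Matrix (Fin n ⊕ Fin n) (Fin n ⊕ Fin n) ℝ) : Matrix (Fin n) (Fin n) ℂ :=
  Matrix.of fun i j => ⟨X (Sum.inl i) (Sum.inl j) + X (Sum.inr i) (Sum.inr j),
    X (Sum.inr i) (Sum.inl j) - X (Sum.inl i) (Sum.inr j)⟩

theorem toC_psd {n : ℕ} {X : Matrix (Fin n ⊕ Fin n) (Fin n ⊕ Fin n) ℝ} (hX : X.PosSemidef) :
    (toC X).PosSemidef := by
  classical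
  obtain ⟨Y, rfl⟩ := psd_factor hX
  let V : Matrix (Fin n ⊕ Fin n) (Fin n) ℂ :=
    Matrix.of fun k i => ⟨Y k (Sum.inl i), - Y k (Sum.inr i)⟩
  have : toC (Yᴴ * Y) = Vᴴ * V := by
    ext i j
    apply Complex.ext
    · simp only [toC, V, Matrix.mul_apply, Matrix.of_apply, Matrix.conjTranspose_apply,
        Complex.re_sum, Complex.mul_re, star_trivial, ← Finset.sum_add_distrib]
      apply Finset.sum_congr rfl
      intros; simp
    · simp only [toC, V, Matrix.mul_apply, Matrix.of_apply, Matrix.conjTranspose_apply,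
        Complex.im_sum, Complex.mul_im, star_trivial, ← Finset.sum_sub_distrib]
      apply Finset.sum_congr rfl
      intros; simp; ring
  rw [this]
  exact Matrix.posSemidef_conjTranspose_mul_self _

theorem trace_toC {n : ℕ} (H : Matrix (Fin n) (Fin n) ℂ)
    (X : Matrix (Fin n ⊕ Fin n) (Fin n ⊕ Fin n) ℝ) :
    ((H * toC X).trace).re = (Lam H * X).trace := by
  simp only [Matrix.trace, Matrix.diag, Matrix.mul_apply, Fintype.sum_sum_type, Lam, toC,
    Complex.re_sum, ← Finset.sum_add_distrib]
  apply Finset.sum_congr rfl; intros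
  apply Finset.sum_congr rfl; intros
  simp; ring

theorem toC_Lam {n : ℕ} (Z : Matrix (Fin n) (Fin n) ℂ) : toC ((1/2 : ℝ) • Lam Z) = Z := by
  ext i j
  apply Complex.ext <;> simp [toC, Lam] <;> ring

theorem key {n : ℕ} {Z : Matrix (Fin n) (Fin n) ℂ} (hZ : Z.PosSemidef) :
    ∃ X, X.IsSymm ∧ X.PosSemidef ∧ CBlock n X ∧ toC X = Z := by
  have hp : ((1/2 : ℝ) • Lam Z).PosSemidef := (Lam_psd hZ).smul (by norm_num)
  have hs : (Z.map Complex.im)ᵀ = - Z.map Complex.im := by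
    ext i j
    have := congrArg Complex.im (hZ.1.apply i j)
    simp at this ⊢
    linarith
  refine ⟨(1/2 : ℝ) • Lam Z, ?_, hp, ⟨(1/2 : ℝ) • Z.map Complex.re, (1/2 : ℝ) • Z.map Complex.im,
    _, ?_, rfl, ?_⟩, toC_Lam Z⟩
  · simpa [Matrix.IsHermitian, Matrix.IsSymm] using hp.1
  · rw [Matrix.transpose_smul, hs, Lam, Matrix.fromBlocks_smul]
  · rw [Matrix.transpose_smul, hs, smul_neg]

/-- The optimal values of SDP-ℂ, CSDP-ℝ and SDP-ℝ all coincide. -/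
theorem stmt1 (n m : ℕ) (H0 : Matrix (Fin n) (Fin n) ℂ)
    (H : Fin m → Matrix (Fin n) (Fin n) ℂ) (h : Fin m → ℝ)
    (hH0 : H0.IsHermitian) (hH : ∀ i, (H i).IsHermitian) :
    valSDPC n m H0 H h = valCSDPR n m H0 H h ∧
    valCSDPR n m H0 H h = valSDPR n m H0 H h := by
  have h1 : valCSDPR n m H0 H h ≤ valSDPC n m H0 H h := by
    apply sInf_le_sInf
    rintro x ⟨Z, hZ, hc, rfl⟩
    obtain ⟨X, hs, hp, hb, rfl⟩ := key hZ
    exact ⟨X, hs, hp, fun i => by rw [← trace_toC]; exact hc i, hb, by rw [trace_toC]⟩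
  have h2 : valSDPR n m H0 H h ≤ valCSDPR n m H0 H h := by
    apply sInf_le_sInf
    rintro x ⟨X, hs, hp, hc, hb, rfl⟩
    exact ⟨X, hs, hp, hc, rfl⟩
  have h3 : valSDPC n m H0 H h ≤ valSDPR n m H0 H h := by
    apply sInf_le_sInf
    rintro x ⟨X, hs, hp, hc, rfl⟩
    exact ⟨toC X, toC_psd hp, fun i => by rw [trace_toC]; exact hc i, by rw [trace_toC]⟩
  exact ⟨le_antisymm (h3.trans h2) h1, le_antisymm (h1.trans h3) h2⟩
end
end

section
/- (Putinar–Scheiderer.) Under the sphere assumption, an infinite array y ∈ H has a representing measure on K (i.e., there exists a positive finite Borel measure μ on K with y_{α,β} = ∫_K z̄^α z^β dμ for all α, β ∈ ℕⁿ) if and only if M_d(g_i y) ⪰ 0 for i = 0, …, m and every d ∈ ℕ. -/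
open scoped BigOperators ComplexOrder
open Classical Filter

noncomputable section

/-- Multi-indices in `ℕⁿ`. -/
abbrev MIdx (n : ℕ) := Fin n → ℕ

/-- `|α| = α₁ + ⋯ + αₙ`. -/
def mdeg {n : ℕ} (α : MIdx n) : ℕ := ∑ i, α i

/-- The monomial `z^α := z₁^{α₁} ⋯ zₙ^{αₙ}`. -/
def mpow {n : ℕ} (z : Fin n → ℂ) (α : MIdx n) : ℂ := ∏ i, z i ^ α i

/-- Evaluation of the coefficient array `c` as the (real part of the) complex
polynomial `z ↦ Σ_{α,β} c_{α,β} z̄^α z^β`. -/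
def peval {n : ℕ} (c : MIdx n → MIdx n → ℂ) (z : Fin n → ℂ) : ℝ :=
  (∑ᶠ α : MIdx n, ∑ᶠ β : MIdx n, c α β * (starRingEnd ℂ) (mpow z α) * mpow z β).re

/-- Evaluation of a holomorphic polynomial with coefficients `p`. -/
def hpeval {n : ℕ} (p : MIdx n → ℂ) (z : Fin n → ℂ) : ℂ :=
  ∑ᶠ α : MIdx n, p α * mpow z α

/-- `σ ∈ Σ_d[z]`: `σ` is a finite sum of squared moduli of holomorphic polynomials
of degree at most `d`. -/
def IsSOSUpTo {n : ℕ} (d : ℕ) (σ : (Fin n → ℂ) → ℝ) : Prop :=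
  ∃ (r : ℕ) (p : Fin r → MIdx n → ℂ),
    (∀ j α, p j α ≠ 0 → mdeg α ≤ d) ∧
    ∀ z, σ z = ∑ j, Complex.normSq (hpeval (p j) z)

/-- `σ ∈ Σ[z]`. -/
def IsSOS {n : ℕ} (σ : (Fin n → ℂ) → ℝ) : Prop := ∃ d, IsSOSUpTo d σ

/-- Hermitian coefficient array of degree at most `l` (real-valued complex polynomial). -/
def IsPolyDeg {n : ℕ} (l : ℕ) (c : MIdx n → MIdx n → ℂ) : Prop :=
  (∀ α β, c α β ≠ 0 → mdeg α ≤ l ∧ mdeg β ≤ l) ∧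
  (∀ α β, (starRingEnd ℂ) (c α β) = c β α)

/-- `c` has a nonzero coefficient `c_{α,β}` with `|α| = l` (degree exactly `l`). -/
def HasTopDeg {n : ℕ} (l : ℕ) (c : MIdx n → MIdx n → ℂ) : Prop :=
  ∃ α β, mdeg α = l ∧ mdeg β ≤ l ∧ c α β ≠ 0

/-- Multi-indices of degree at most `e`, indexing moment matrices. -/
def Idx (n e : ℕ) := {α : MIdx n // mdeg α ≤ e}

noncomputable instance {n e : ℕ} : Fintype (Idx n e) :=
  Fintype.ofInjective
    (fun a : Idx n e => (fun i =>
      (⟨a.1 i, Nat.lt_succ_of_le (le_trans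
        (Finset.single_le_sum (f := a.1) (fun j _ => Nat.zero_le _) (Finset.mem_univ i))
        a.2)⟩ : Fin (e + 1)) : Fin n → Fin (e + 1)))
    (fun a b h => Subtype.ext (funext fun i => congrArg Fin.val (congrFun h i)))

/-- Entry `(α,β)` of the localizing matrix `M(φ y)`:
`Σ_{γ,δ} φ_{γ,δ} y_{α+γ, β+δ}`. -/
def momEntry {n : ℕ} (φ y : MIdx n → MIdx n → ℂ) (α β : MIdx n) : ℂ :=
  ∑ᶠ γ : MIdx n, ∑ᶠ δ : MIdx n, φ γ δ * y (α + γ) (β + δ)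

/-- The localizing matrix `M_e(φ y)` indexed by multi-indices of degree at most `e`. -/
def momMatrix (n e : ℕ) (φ y : MIdx n → MIdx n → ℂ) :
    Matrix (Idx n e) (Idx n e) ℂ :=
  Matrix.of fun a b => momEntry φ y a.1 b.1

/-- The moment matrix `M_e(y)` indexed by multi-indices of degree at most `e`. -/
def momMatrixId (n e : ℕ) (y : MIdx n → MIdx n → ℂ) :
    Matrix (Idx n e) (Idx n e) ℂ :=
  Matrix.of fun a b => y a.1 b.1

/-- The Riesz functional `L_y(c) = Σ_{α,β} c_{α,β} y_{α,β}` (real part). -/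
def Ly {n : ℕ} (c y : MIdx n → MIdx n → ℂ) : ℝ :=
  (∑ᶠ α : MIdx n, ∑ᶠ β : MIdx n, c α β * y α β).re

/-- `y ∈ H_d`: hermitian array truncated at degree `d`. -/
def HermArr (n d : ℕ) (y : MIdx n → MIdx n → ℂ) : Prop :=
  ∀ α β : MIdx n, mdeg α ≤ d → mdeg β ≤ d → (starRingEnd ℂ) (y α β) = y β α

/-- The feasible set `K = {z : g_i(z) ≥ 0, i = 1,…,m}`. -/
def Kset {n m : ℕ} (g : Fin m → MIdx n → MIdx n → ℂ) : Set (Fin n → ℂ) :=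
  {z | ∀ i, 0 ≤ peval (g i) z}

/-- Coefficients of the polynomial `s(z) = R² − |z₁|² − ⋯ − |zₙ|²`. -/
def spherePoly (n : ℕ) (R : ℝ) : MIdx n → MIdx n → ℂ := fun α β =>
  if α = 0 ∧ β = 0 then ((R ^ 2 : ℝ) : ℂ)
  else if ∃ i : Fin n, α = Pi.single i 1 ∧ β = Pi.single i 1 then -1 else 0

/-- Feasibility for the complex moment relaxation of order `d`. -/
def MomFeas (n m d : ℕ) (g : Fin m → MIdx n → MIdx n → ℂ) (kk : Fin m → ℕ)
    (y : MIdx n → MIdx n → ℂ) : Prop :=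
  HermArr n d y ∧ y 0 0 = 1 ∧ (momMatrixId n d y).PosSemidef ∧
    ∀ i, (momMatrix n (d - kk i) (g i) y).PosSemidef

/-- `ρ_d`: optimal value of the complex moment relaxation of order `d`. -/
def rhoMom (n m d : ℕ) (f : MIdx n → MIdx n → ℂ) (g : Fin m → MIdx n → MIdx n → ℂ)
    (kk : Fin m → ℕ) : EReal :=
  sInf {x : EReal | ∃ y, MomFeas n m d g kk y ∧ x = ((Ly f y : ℝ) : EReal)}

/-- A degree-`d` sum-of-squares certificate `f − λ = Σ_{i=0}^m σ_i g_i`. -/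
def SOSCert (n m d : ℕ) (f : MIdx n → MIdx n → ℂ) (g : Fin m → MIdx n → MIdx n → ℂ)
    (kk : Fin m → ℕ) (lam : ℝ) : Prop :=
  ∃ (σ0 : (Fin n → ℂ) → ℝ) (σ : Fin m → (Fin n → ℂ) → ℝ),
    IsSOSUpTo d σ0 ∧ (∀ i, IsSOSUpTo (d - kk i) (σ i)) ∧
    ∀ z, peval f z - lam = σ0 z + ∑ i, σ i z * peval (g i) z

/-- `ρ_d*`: optimal value of the complex sum-of-squares relaxation of order `d`. -/
def rhoSOS (n m d : ℕ) (f : MIdx n → MIdx n → ℂ) (g : Fin m → MIdx n → MIdx n → ℂ)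
    (kk : Fin m → ℕ) : EReal :=
  sSup {x : EReal | ∃ lam : ℝ, SOSCert n m d f g kk lam ∧ x = ((lam : ℝ) : EReal)}

/-- `f^opt = inf_K f` as an extended real number. -/
def fOpt (n m : ℕ) (f : MIdx n → MIdx n → ℂ) (g : Fin m → MIdx n → MIdx n → ℂ) : EReal :=
  sInf {x : EReal | ∃ z ∈ Kset g, x = ((peval f z : ℝ) : EReal)}

/-- Sphere assumption: two of the constraint polynomials are `s` and `−s` where
`s(z) = R² − |z₁|² − ⋯ − |zₙ|²`. -/
def SphereAssumption (n m : ℕ) (g : Fin m → MIdx n → MIdx n → ℂ) (R : ℝ) : Prop :=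
  0 < R ∧ ∃ i₁ i₂ : Fin m, i₁ ≠ i₂ ∧ g i₁ = spherePoly n R ∧
    (∀ α β, g i₂ α β = -(spherePoly n R α β))

open MeasureTheory



/-- positive semidefinite kernels -/
def PK {n : ℕ} (m : MIdx n → MIdx n → ℂ) : Prop :=
  (∀ α β, (starRingEnd ℂ) (m α β) = m β α) ∧
  ∀ (ι : Type) [Fintype ι] (a : ι → MIdx n) (c : ι → ℂ),
    0 ≤ ∑ k, ∑ l, (starRingEnd ℂ) (c k) * m (a k) (a l) * c l

def tw {n : ℕ} (i : Fin n) (u : ℂ) (m : MIdx n → MIdx n → ℂ) : MIdx n → MIdx n → ℂ :=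
  fun α β => m (α + Pi.single i 1) (β + Pi.single i 1) +
    (starRingEnd ℂ) u * m α (β + Pi.single i 1) + u * m (α + Pi.single i 1) β +
    (starRingEnd ℂ) u * u * m α β

lemma PK.add {n : ℕ} {m m' : MIdx n → MIdx n → ℂ} (h : PK m) (h' : PK m') : PK (m + m') := by
  refine ⟨fun α β => by simp [h.1, h'.1], fun ι _ a c => ?_⟩
  have := add_nonneg (h.2 ι a c) (h'.2 ι a c)
  simpa [mul_add, add_mul, Finset.sum_add_distrib] using this

lemma PK.smul {n : ℕ} {m : MIdx n → MIdx n → ℂ} (h : PK m) {t : ℝ} (ht : 0 ≤ t) :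
    PK (t • m) := by
  refine ⟨fun α β => by simp [h.1], fun ι _ a c => ?_⟩
  have h1 : (0 : ℂ) ≤ (t : ℂ) := by exact_mod_cast ht
  have := mul_nonneg h1 (h.2 ι a c)
  convert this using 1
  simp only [Finset.mul_sum]
  refine Finset.sum_congr rfl fun k _ => Finset.sum_congr rfl fun l _ => ?_
  simp
  ring

lemma PK.zero {n : ℕ} : PK (0 : MIdx n → MIdx n → ℂ) := by
  refine ⟨fun α β => by simp, fun ι _ a c => by simp⟩

lemma PK.tw {n : ℕ} {m : MIdx n → MIdx n → ℂ} (h : PK m) (i : Fin n) (u : ℂ) :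
    PK (tw i u m) := by
  refine ⟨fun α β => by simp [_root_.tw, h.1]; ring, fun ι _ a c => ?_⟩
  have := h.2 (ι ⊕ ι) (Sum.elim (fun k => a k + Pi.single i 1) a)
    (Sum.elim c (fun k => u * c k))
  convert this using 1
  simp only [Fintype.sum_sum_type, Sum.elim_inl, Sum.elim_inr, ← Finset.sum_add_distrib]
  refine Finset.sum_congr rfl fun k _ => Finset.sum_congr rfl fun l _ => ?_
  simp [_root_.tw]
  ring

lemma PK.diag {n : ℕ} {m : MIdx n → MIdx n → ℂ} (h : PK m) (α : MIdx n) : 0 ≤ m α α := by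
  simpa using h.2 Unit (fun _ => α) (fun _ => 1)

lemma PK.bound {n : ℕ} {m : MIdx n → MIdx n → ℂ} (h : PK m) (α β : MIdx n) :
    ‖m α β‖ ≤ (m α α).re + (m β β).re := by
  by_cases h0 : m α β = 0
  · simp only [h0, norm_zero]
    exact add_nonneg (Complex.nonneg_iff.1 (h.diag α)).1 (Complex.nonneg_iff.1 (h.diag β)).1
  set w := m α β with hw
  have hn : (‖w‖ : ℂ) ≠ 0 := by simpa using h0
  have key := h.2 (Fin 2) ![α, β] ![1, -(starRingEnd ℂ) w / ‖w‖]
  have hba : m β α = (starRingEnd ℂ) w := (h.1 α β).symm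
  have e1 : w * (starRingEnd ℂ) w = (‖w‖ : ℂ) ^ 2 := Complex.mul_conj' w
  simp only [Fin.sum_univ_two, Matrix.cons_val_zero, Matrix.cons_val_one, hba, ← hw] at key
  have e2 : (starRingEnd ℂ) (1:ℂ) * m α α * 1 + (starRingEnd ℂ) 1 * w * (-(starRingEnd ℂ) w / ‖w‖) +
      ((starRingEnd ℂ) (-(starRingEnd ℂ) w / ‖w‖) * (starRingEnd ℂ) w * 1 +
        (starRingEnd ℂ) (-(starRingEnd ℂ) w / ‖w‖) * m β β * (-(starRingEnd ℂ) w / ‖w‖)) =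
      m α α + m β β - 2 * (‖w‖ : ℂ) := by
    simp only [map_div₀, map_neg, Complex.conj_conj, map_one, Complex.conj_ofReal]
    field_simp
    linear_combination (-2 * (‖w‖ : ℂ) + m β β) * e1
  rw [e2] at key
  have k2 := (Complex.nonneg_iff.1 key).1
  simp at k2
  have hp := norm_nonneg w
  linarith

lemma PK.norm_eq_zero {n : ℕ} {m : MIdx n → MIdx n → ℂ} (h : PK m) (h' : PK (-m)) : m = 0 := by
  have hd : ∀ α, (m α α).re = 0 := fun α => by
    have h1 := (Complex.nonneg_iff.1 (h.diag α)).1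
    have h2 := (Complex.nonneg_iff.1 (h'.diag α)).1
    simp at h2
    linarith
  funext α β
  have := h.bound α β
  rw [hd, hd] at this
  simpa using this

def degSet (n l : ℕ) : Finset (MIdx n) :=
  Finset.univ.image (fun a : Idx n l => a.1)

lemma mem_degSet {n l : ℕ} {α : MIdx n} : α ∈ degSet n l ↔ mdeg α ≤ l := by
  simp only [degSet, Finset.mem_image, Finset.mem_univ, true_and]
  exact ⟨fun ⟨a, ha⟩ => ha ▸ a.2, fun h => ⟨⟨α, h⟩, rfl⟩⟩

lemma finsum2_eq {n l : ℕ} {φ : MIdx n → MIdx n → ℂ}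
    (hφ : ∀ α β, φ α β ≠ 0 → mdeg α ≤ l ∧ mdeg β ≤ l) (f : MIdx n → MIdx n → ℂ) :
    (∑ᶠ γ : MIdx n, ∑ᶠ δ : MIdx n, φ γ δ * f γ δ) =
      ∑ γ ∈ degSet n l, ∑ δ ∈ degSet n l, φ γ δ * f γ δ := by
  have h1 : ∀ γ, (∑ᶠ δ : MIdx n, φ γ δ * f γ δ) = ∑ δ ∈ degSet n l, φ γ δ * f γ δ := fun γ => by
    apply finsum_eq_sum_of_support_subset
    intro δ hδ
    rw [Finset.mem_coe, mem_degSet]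
    exact (hφ γ δ (left_ne_zero_of_mul hδ)).2
  simp only [h1]
  apply finsum_eq_sum_of_support_subset
  intro γ hγ
  obtain ⟨δ, _, hδ⟩ := Finset.exists_ne_zero_of_sum_ne_zero hγ
  rw [Finset.mem_coe, mem_degSet]
  exact (hφ γ δ (left_ne_zero_of_mul hδ)).1

lemma momEntry_eq {n l : ℕ} {φ : MIdx n → MIdx n → ℂ}
    (hφ : ∀ α β, φ α β ≠ 0 → mdeg α ≤ l ∧ mdeg β ≤ l) (y : MIdx n → MIdx n → ℂ) (α β : MIdx n) :
    momEntry φ y α β =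
      ∑ γ ∈ degSet n l, ∑ δ ∈ degSet n l, φ γ δ * y (α + γ) (β + δ) :=
  finsum2_eq hφ _

lemma momEntry_add {n l : ℕ} {φ : MIdx n → MIdx n → ℂ}
    (hφ : ∀ α β, φ α β ≠ 0 → mdeg α ≤ l ∧ mdeg β ≤ l) (y y' : MIdx n → MIdx n → ℂ) :
    momEntry φ (y + y') = momEntry φ y + momEntry φ y' := by
  funext α β
  simp [momEntry_eq hφ, mul_add, Finset.sum_add_distrib]

lemma momEntry_smul {n l : ℕ} {φ : MIdx n → MIdx n → ℂ}
    (hφ : ∀ α β, φ α β ≠ 0 → mdeg α ≤ l ∧ mdeg β ≤ l) (t : ℝ) (y : MIdx n → MIdx n → ℂ) :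
    momEntry φ (t • y) = t • momEntry φ y := by
  funext α β
  simp only [momEntry_eq hφ, Pi.smul_apply, Finset.smul_sum, mul_smul_comm]

lemma momEntry_tw {n l : ℕ} {φ : MIdx n → MIdx n → ℂ}
    (hφ : ∀ α β, φ α β ≠ 0 → mdeg α ≤ l ∧ mdeg β ≤ l) (i : Fin n) (u : ℂ)
    (y : MIdx n → MIdx n → ℂ) :
    momEntry φ (tw i u y) = tw i u (momEntry φ y) := by
  funext α β
  simp only [tw, momEntry_eq hφ, Finset.mul_sum, ← Finset.sum_add_distrib]
  refine Finset.sum_congr rfl fun γ _ => Finset.sum_congr rfl fun δ _ => ?_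
  rw [add_right_comm α γ, add_right_comm β δ]
  ring

/-- the cone of all arrays satisfying the positivity constraints -/
def Pc {n m : ℕ} (g : Fin m → MIdx n → MIdx n → ℂ) (y : MIdx n → MIdx n → ℂ) : Prop :=
  PK y ∧ ∀ i, PK (momEntry (g i) y)

lemma PK_iff {n : ℕ} (m : MIdx n → MIdx n → ℂ) :
    PK m ↔ ∀ d : ℕ, (Matrix.of fun a b : Idx n d => m a.1 b.1).PosSemidef := by
  constructor
  · intro h d
    refine Matrix.PosSemidef.of_dotProduct_mulVec_nonneg ?_ fun x => ?_
    · ext a b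
      simpa using h.1 b.1 a.1
    · have := h.2 (Idx n d) (fun a => a.1) x
      simpa [dotProduct, Matrix.mulVec, Finset.mul_sum, mul_assoc] using this
  · intro h
    refine ⟨fun α β => ?_, fun ι _ a c => ?_⟩
    · have := (h (mdeg α + mdeg β)).1.apply ⟨β, by omega⟩ ⟨α, by omega⟩
      exact this
    · have hs : ∀ k, mdeg (a k) ≤ ∑ k, mdeg (a k) := fun k =>
        Finset.single_le_sum (f := fun k => mdeg (a k)) (fun _ _ => Nat.zero_le _) (Finset.mem_univ k)
      have := ((h (∑ k, mdeg (a k))).submatrix (fun k => ⟨a k, hs k⟩)).dotProduct_mulVec_nonneg c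
      simp only [dotProduct, Matrix.mulVec, Finset.mul_sum, ← mul_assoc] at this
      exact this

lemma Pc_iff {n m : ℕ} (g : Fin m → MIdx n → MIdx n → ℂ) (y : MIdx n → MIdx n → ℂ) :
    Pc g y ↔ ∀ d : ℕ, (momMatrixId n d y).PosSemidef ∧
      ∀ i, (momMatrix n d (g i) y).PosSemidef := by
  simp only [Pc, PK_iff, momMatrixId, momMatrix]
  exact ⟨fun h d => ⟨h.1 d, fun i => h.2 i d⟩, fun h => ⟨fun d => (h d).1, fun i d => (h d).2 i⟩⟩

lemma mdeg_single {n : ℕ} (i : Fin n) : mdeg (Pi.single i 1 : MIdx n) = 1 := by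
  simp [mdeg, Finset.sum_pi_single']

lemma mdeg_zero {n : ℕ} : mdeg (0 : MIdx n) = 0 := by
  simp [mdeg]

lemma mdeg_add {n : ℕ} (α β : MIdx n) : mdeg (α + β) = mdeg α + mdeg β := by
  simp [mdeg, Finset.sum_add_distrib]

lemma single_ne_zero' {n : ℕ} (i : Fin n) : (Pi.single i 1 : MIdx n) ≠ 0 := by
  intro h
  have := congrArg mdeg h
  rw [mdeg_single, mdeg_zero] at this
  omega

lemma spherePoly_eq {n : ℕ} (R : ℝ) (γ δ : MIdx n) :
    spherePoly n R γ δ = (if γ = 0 then (if δ = 0 then ((R ^ 2 : ℝ) : ℂ) else 0) else 0) -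
      ∑ i : Fin n, (if γ = Pi.single i 1 then (if δ = Pi.single i 1 then (1 : ℂ) else 0) else 0) := by
  unfold spherePoly
  by_cases h0 : γ = 0 ∧ δ = 0
  · obtain ⟨rfl, rfl⟩ := h0
    simp [(single_ne_zero' _).symm]
  · rw [if_neg h0]
    have h1 : (if γ = 0 then (if δ = 0 then ((R ^ 2 : ℝ) : ℂ) else 0) else 0) = 0 := by
      split_ifs <;> simp_all
    rw [h1]
    split_ifs with h
    · obtain ⟨j, rfl, rfl⟩ := h
      rw [Finset.sum_eq_single j]
      · simp
      · intro i _ hij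
        rw [if_neg]
        intro h
        have := congrFun h j
        simp [Pi.single_apply, hij.symm] at this
      · simp
    · rw [Finset.sum_eq_zero]
      · simp
      · intro i _
        split_ifs with ha hb
        · exact (h ⟨i, ha, hb⟩).elim
        · rfl
        · rfl

lemma spherePoly_deg {n : ℕ} (R : ℝ) (α β : MIdx n) (h : spherePoly n R α β ≠ 0) :
    mdeg α ≤ 1 ∧ mdeg β ≤ 1 := by
  unfold spherePoly at h
  split_ifs at h with h1 h2
  · simp [h1.1, h1.2, mdeg_zero]
  · obtain ⟨j, rfl, rfl⟩ := h2
    simp [mdeg_single]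
  · exact (h rfl).elim

lemma momEntry_sphere {n : ℕ} (R : ℝ) (y : MIdx n → MIdx n → ℂ) (α β : MIdx n) :
    momEntry (spherePoly n R) y α β =
      ((R ^ 2 : ℝ) : ℂ) * y α β - ∑ i, y (α + Pi.single i 1) (β + Pi.single i 1) := by
  rw [momEntry_eq (spherePoly_deg R)]
  simp only [spherePoly_eq, sub_mul, Finset.sum_sub_distrib, Finset.sum_mul, ite_mul, zero_mul,
    one_mul]
  congr 1
  · have h0 : (0 : MIdx n) ∈ degSet n 1 := by simp [mem_degSet, mdeg_zero]
    rw [Finset.sum_eq_single 0]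
    · rw [Finset.sum_eq_single 0]
      · simp
      · intro b _ hb
        simp [hb]
      · exact fun h => (h h0).elim
    · intro b _ hb
      simp [hb]
    · exact fun h => (h h0).elim
  · have e : ∀ γ : MIdx n, (∑ δ ∈ degSet n 1, ∑ i : Fin n,
        (if γ = Pi.single i 1 then
          (if δ = Pi.single i 1 then y (α + γ) (β + δ) else 0) else 0)) =
        ∑ i : Fin n, ∑ δ ∈ degSet n 1, 
        (if γ = Pi.single i 1 then
          (if δ = Pi.single i 1 then y (α + γ) (β + δ) else 0) else 0) := fun γ =>
      Finset.sum_comm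
    rw [Finset.sum_congr rfl fun γ _ => e γ, Finset.sum_comm]
    refine Finset.sum_congr rfl fun i _ => ?_
    have h0 : (Pi.single i 1 : MIdx n) ∈ degSet n 1 := by simp [mem_degSet, mdeg_single]
    rw [Finset.sum_eq_single (Pi.single i 1)]
    · rw [Finset.sum_eq_single (Pi.single i 1)]
      · simp
      · intro b _ hb
        simp [hb]
      · exact fun h => (h h0).elim
    · intro b _ hb
      simp [hb]
    · exact fun h => (h h0).elim

section cone

variable {n m : ℕ} {g : Fin m → MIdx n → MIdx n → ℂ} {kk : Fin m → ℕ} {R : ℝ}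

lemma Pc.add (hg : ∀ i, IsPolyDeg (kk i) (g i)) {y y' : MIdx n → MIdx n → ℂ} (h : Pc g y)
    (h' : Pc g y') : Pc g (y + y') :=
  ⟨h.1.add h'.1, fun i => by rw [momEntry_add (hg i).1]; exact (h.2 i).add (h'.2 i)⟩

lemma Pc.smul (hg : ∀ i, IsPolyDeg (kk i) (g i)) {y : MIdx n → MIdx n → ℂ} (h : Pc g y)
    {t : ℝ} (ht : 0 ≤ t) : Pc g (t • y) :=
  ⟨h.1.smul ht, fun i => by rw [momEntry_smul (hg i).1]; exact (h.2 i).smul ht⟩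

lemma Pc.tw (hg : ∀ i, IsPolyDeg (kk i) (g i)) {y : MIdx n → MIdx n → ℂ} (h : Pc g y)
    (j : Fin n) (u : ℂ) : Pc g (tw j u y) :=
  ⟨h.1.tw j u, fun i => by rw [momEntry_tw (hg i).1]; exact (h.2 i).tw j u⟩

lemma Pc.zero (hg : ∀ i, IsPolyDeg (kk i) (g i)) : Pc g (0 : MIdx n → MIdx n → ℂ) :=
  ⟨PK.zero, fun i => by
    have := momEntry_smul (hg i).1 0 0
    rw [zero_smul, zero_smul] at this
    rw [this]
    exact PK.zero⟩

lemma Pc.sum (hg : ∀ i, IsPolyDeg (kk i) (g i)) {ι : Type} (s : Finset ι)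
    (f : ι → MIdx n → MIdx n → ℂ) (h : ∀ j ∈ s, Pc g (f j)) : Pc g (∑ j ∈ s, f j) := by
  induction s using Finset.induction_on with
  | empty => simpa using Pc.zero hg
  | insert a s ha ih =>
    rw [Finset.sum_insert ha]
    exact Pc.add hg (h _ (by simp)) (ih fun j hj => h j (by simp [hj]))

lemma Pc.sphere (hs : SphereAssumption n m g R) {y : MIdx n → MIdx n → ℂ} (h : Pc g y)
    (α β : MIdx n) :
    ∑ i, y (α + Pi.single i 1) (β + Pi.single i 1) = ((R ^ 2 : ℝ) : ℂ) * y α β := by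
  obtain ⟨_, i₁, i₂, _, h1, h2⟩ := hs
  have e1 := h.2 i₁
  have e2 := h.2 i₂
  rw [h1] at e1
  have h2' : g i₂ = fun α β => -(spherePoly n R α β) := by
    funext α β
    exact h2 α β
  have e3 : momEntry (g i₂) y = - momEntry (spherePoly n R) y := by
    rw [h2']
    funext α β
    rw [momEntry_eq (l := 1)
      (fun α β hh => spherePoly_deg R α β (by simpa using hh))]
    simp [momEntry_eq (spherePoly_deg R)]
  rw [e3] at e2
  have := congrFun (congrFun (e1.norm_eq_zero e2) α) β
  rw [momEntry_sphere] at this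
  simp at this
  push_cast
  linear_combination -this

lemma Pc.step (hs : SphereAssumption n m g R) {y : MIdx n → MIdx n → ℂ} (h : Pc g y)
    (α : MIdx n) (i : Fin n) :
    (y (α + Pi.single i 1) (α + Pi.single i 1)).re ≤ R ^ 2 * (y α α).re := by
  have := congrArg Complex.re (h.sphere hs α α)
  rw [Complex.re_sum, Complex.re_ofReal_mul] at this
  rw [← this]
  exact Finset.single_le_sum
    (f := fun i => (y (α + Pi.single i 1) (α + Pi.single i 1)).re)
    (fun j _ => (Complex.nonneg_iff.1 (h.1.diag _)).1) (Finset.mem_univ i)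

lemma exists_pred {α : MIdx n} (h : mdeg α ≠ 0) :
    ∃ (i : Fin n) (α' : MIdx n), α = α' + Pi.single i 1 := by
  obtain ⟨i, _, hi⟩ := Finset.exists_ne_zero_of_sum_ne_zero h
  refine ⟨i, α - Pi.single i 1, (tsub_add_cancel_of_le ?_).symm⟩
  intro j
  by_cases hj : j = i
  · subst hj; simp; omega
  · simp [hj]

lemma midx_induction {p : MIdx n → Prop} (h0 : p 0)
    (hs : ∀ α i, p α → p (α + Pi.single i 1)) (α : MIdx n) : p α := by
  generalize hd : mdeg α = d
  induction d generalizing α with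
  | zero =>
    have : α = 0 := by
      by_contra hne
      apply hne
      funext i
      have := Finset.sum_eq_zero_iff.1 hd i (Finset.mem_univ i)
      simpa using this
    rwa [this]
  | succ d ih =>
    obtain ⟨i, α', rfl⟩ := exists_pred (α := α) (by omega)
    rw [mdeg_add, mdeg_single] at hd
    exact hs _ _ (ih α' (by omega))

lemma Pc.diag_bound (hs : SphereAssumption n m g R) {y : MIdx n → MIdx n → ℂ} (h : Pc g y)
    (α : MIdx n) : (y α α).re ≤ (R ^ 2) ^ mdeg α * (y 0 0).re := by
  induction α using midx_induction with
  | h0 => simp [mdeg_zero]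
  | hs α i ih =>
    rw [mdeg_add, mdeg_single, pow_succ]
    have := h.step hs α i
    have := mul_le_mul_of_nonneg_left ih (sq_nonneg R)
    linarith

lemma Pc.bound (hs : SphereAssumption n m g R) {y : MIdx n → MIdx n → ℂ} (h : Pc g y)
    (α β : MIdx n) : ‖y α β‖ ≤ ((R ^ 2) ^ mdeg α + (R ^ 2) ^ mdeg β) * (y 0 0).re := by
  have h1 := h.1.bound α β
  have h2 := h.diag_bound hs α
  have h3 := h.diag_bound hs β
  linarith

lemma Pc.eq_zero (hs : SphereAssumption n m g R) {y : MIdx n → MIdx n → ℂ} (h : Pc g y)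
    (h0 : (y 0 0).re = 0) : y = 0 := by
  funext α β
  have := h.bound hs α β
  rw [h0, mul_zero] at this
  simpa using this

lemma Pc.ofReal {y : MIdx n → MIdx n → ℂ} (h : Pc g y) : y 0 0 = ((y 0 0).re : ℂ) := by
  have := (Complex.nonneg_iff.1 (h.1.diag 0)).2
  apply Complex.ext <;> simp [← this]

/-- base of the cone -/
def Cset (g : Fin m → MIdx n → MIdx n → ℂ) : Set (MIdx n → MIdx n → ℂ) :=
  {y | Pc g y ∧ y 0 0 = 1}

lemma Cset_convex (hg : ∀ i, IsPolyDeg (kk i) (g i)) : Convex ℝ (Cset g) := by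
  intro x hx y hy a b ha hb hab
  refine ⟨(hx.1.smul hg ha).add hg (hy.1.smul hg hb), ?_⟩
  simp only [Pi.add_apply, Pi.smul_apply, hx.2, hy.2]
  simp
  exact_mod_cast hab

lemma continuous_momEntry (hg : ∀ i, IsPolyDeg (kk i) (g i)) (i : Fin m) (α β : MIdx n) :
    Continuous fun y => momEntry (g i) y α β := by
  simp only [momEntry_eq (hg i).1]
  fun_prop

lemma isClosed_PK {X : Type*} [TopologicalSpace X] {f : X → MIdx n → MIdx n → ℂ}
    (hf : ∀ α β, Continuous fun x => f x α β) : IsClosed {x | PK (f x)} := by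
  simp only [PK, Set.setOf_and, Set.setOf_forall]
  refine IsClosed.inter ?_ ?_
  · refine isClosed_iInter fun α => isClosed_iInter fun β => isClosed_eq ?_ (hf _ _)
    exact Complex.continuous_conj.comp (hf _ _)
  · refine isClosed_iInter fun ι => isClosed_iInter fun _ => isClosed_iInter fun a =>
      isClosed_iInter fun c => isClosed_le continuous_const ?_
    fun_prop

lemma Cset_compact (hg : ∀ i, IsPolyDeg (kk i) (g i)) (hs : SphereAssumption n m g R) :
    IsCompact (Cset g) := by
  have hcl : IsClosed (Cset g) := by
    simp only [Cset, Pc, Set.setOf_and, Set.setOf_forall]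
    refine IsClosed.inter (IsClosed.inter (isClosed_PK fun α β => by fun_prop) ?_) ?_
    · exact isClosed_iInter fun i => isClosed_PK fun α β => continuous_momEntry hg i α β
    · exact isClosed_eq (by fun_prop) continuous_const
  have hc : IsCompact (Set.pi Set.univ fun α : MIdx n => Set.pi Set.univ fun β : MIdx n =>
      Metric.closedBall (0 : ℂ) ((R ^ 2) ^ mdeg α + (R ^ 2) ^ mdeg β)) :=
    isCompact_univ_pi fun α => isCompact_univ_pi fun β => isCompact_closedBall _ _
  refine hc.of_isClosed_subset hcl ?_
  intro y hy α _ β _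
  have := hy.1.bound hs α β
  rw [hy.2] at this
  simpa using this

lemma extreme_split (hg : ∀ i, IsPolyDeg (kk i) (g i)) (hs : SphereAssumption n m g R)
    {y a b : MIdx n → MIdx n → ℂ} (hy : y ∈ (Cset g).extremePoints ℝ)
    (ha : Pc g a) (hb : Pc g b) (hab : a + b = y) : a = (a 0 0) • y := by
  have h00 : (a 0 0).re + (b 0 0).re = 1 := by
    have : y 0 0 = 1 := hy.1.2
    rw [← hab] at this
    simpa using congrArg Complex.re this
  have ha0 := (Complex.nonneg_iff.1 (ha.1.diag 0)).1
  have hb0 := (Complex.nonneg_iff.1 (hb.1.diag 0)).1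
  rcases ha0.eq_or_lt with h | h
  · have := ha.eq_zero hs h.symm
    simp [this]
  rcases hb0.eq_or_lt with h' | h'
  · have e := hb.eq_zero hs h'.symm
    have : a = y := by simpa [e] using hab
    have h1 : a 0 0 = 1 := by rw [this]; exact hy.1.2
    rw [h1, one_smul, this]
  have hmem : ∀ {c : MIdx n → MIdx n → ℂ}, Pc g c → 0 < (c 0 0).re →
      ((c 0 0).re)⁻¹ • c ∈ Cset g := by
    intro c hc hc0
    refine ⟨hc.smul hg (inv_nonneg.2 hc0.le), ?_⟩
    have : ((c 0 0).re : ℂ) ≠ 0 := by exact_mod_cast hc0.ne'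
    rw [Pi.smul_apply, Pi.smul_apply, Complex.real_smul]
    conv_lhs => rw [hc.ofReal]
    simp [this]
  have := hy.2 (hmem ha h) (hmem hb h')
    ⟨(a 0 0).re, (b 0 0).re, h, h', h00, by
      rw [smul_smul, smul_smul, mul_inv_cancel₀ h.ne', mul_inv_cancel₀ h'.ne', one_smul, one_smul,
        hab]⟩
  have e : a = (a 0 0).re • y := by
    rw [← this, smul_smul, mul_inv_cancel₀ h.ne', one_smul]
  rw [ha.ofReal]
  conv_lhs => rw [e]
  funext α β
  simp

lemma extreme_tw (hg : ∀ i, IsPolyDeg (kk i) (g i)) (hs : SphereAssumption n m g R)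
    {y : MIdx n → MIdx n → ℂ} (hy : y ∈ (Cset g).extremePoints ℝ) (i : Fin n) (u : ℂ) :
    tw i u y = (tw i u y 0 0) • y := by
  have hR : 0 < R := hs.1
  set c : ℝ := 2 * (R ^ 2 + Complex.normSq u) with hc
  have hc0 : 0 < c := by
    have := Complex.normSq_nonneg u
    positivity
  have hyP := hy.1.1
  have key := extreme_split hg hs hy (a := c⁻¹ • tw i u y)
    (b := c⁻¹ • (tw i (-u) y + (2 : ℝ) • ∑ j ∈ Finset.univ.erase i, tw j 0 y))
    ((hyP.tw hg i u).smul hg (by positivity))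
    (((hyP.tw hg i (-u)).add hg
      ((Pc.sum hg _ _ fun j _ => hyP.tw hg j 0).smul hg (by positivity))).smul hg (by positivity))
    (by
      rw [← smul_add, inv_smul_eq_iff₀ hc0.ne']
      funext α β
      have h1 := hyP.sphere hs α β
      rw [← Finset.add_sum_erase _ _ (Finset.mem_univ i)] at h1
      simp only [Pi.add_apply, Pi.smul_apply, Finset.sum_apply, tw, Complex.real_smul, map_zero,
        zero_mul, add_zero, map_neg, hc]
      push_cast at h1 ⊢
      rw [Complex.normSq_eq_conj_mul_self]
      linear_combination 2 * h1)
  have hc1 : (c : ℂ) ≠ 0 := by exact_mod_cast hc0.ne'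
  funext α β
  have := congrFun (congrFun key α) β
  simp only [Pi.smul_apply, Complex.real_smul, smul_eq_mul, Complex.ofReal_inv] at this ⊢
  field_simp at this
  exact this

lemma extreme_shift (hg : ∀ i, IsPolyDeg (kk i) (g i)) (hs : SphereAssumption n m g R)
    {y : MIdx n → MIdx n → ℂ} (hy : y ∈ (Cset g).extremePoints ℝ) (i : Fin n) (α β : MIdx n) :
    y α (β + Pi.single i 1) = y 0 (Pi.single i 1) * y α β := by
  have h00 : y 0 0 = 1 := hy.1.2
  have F := fun u => congrFun (congrFun (extreme_tw hg hs hy i u) α) β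
  have f1 := F 1
  have f2 := F (-1)
  have f3 := F Complex.I
  have f4 := F (-Complex.I)
  simp only [tw, Pi.smul_apply, smul_eq_mul, map_neg, map_one, Complex.conj_I, zero_add, h00]
    at f1 f2 f3 f4
  have hI : Complex.I * Complex.I = -1 := Complex.I_mul_I
  linear_combination (1/4) * f1 - (1/4) * f2 + (Complex.I/4) * f3 - (Complex.I/4) * f4 +
    ((1/2) * y α (β + Pi.single i 1) - (1/2) * y (α + Pi.single i 1) β
      - (1/2) * y 0 (Pi.single i 1) * y α β + (1/2) * y (Pi.single i 1) 0 * y α β) * hI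

lemma mpow_zero {z : Fin n → ℂ} : mpow z 0 = 1 := by simp [mpow]

lemma mpow_add {z : Fin n → ℂ} (α β : MIdx n) : mpow z (α + β) = mpow z α * mpow z β := by
  simp [mpow, pow_add, Finset.prod_mul_distrib]

lemma mpow_single {z : Fin n → ℂ} (i : Fin n) : mpow z (Pi.single i 1) = z i := by
  rw [mpow, Finset.prod_eq_single i]
  · simp
  · intro j _ hj
    simp [hj]
  · simp

lemma extreme_eval (hg : ∀ i, IsPolyDeg (kk i) (g i)) (hs : SphereAssumption n m g R)
    {y : MIdx n → MIdx n → ℂ} (hy : y ∈ (Cset g).extremePoints ℝ) :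
    ∃ z ∈ Kset g, y = fun α β => (starRingEnd ℂ) (mpow z α) * mpow z β := by
  set z : Fin n → ℂ := fun i => y 0 (Pi.single i 1) with hz
  have hherm := hy.1.1.1.1
  have hrow : ∀ α β, y α β = y α 0 * mpow z β := by
    intro α β
    induction β using midx_induction with
    | h0 => simp [mpow_zero]
    | hs β i ih =>
      rw [extreme_shift hg hs hy, ih, mpow_add, mpow_single]
      ring
  have hval : y = fun α β => (starRingEnd ℂ) (mpow z α) * mpow z β := by
    funext α β
    rw [hrow, ← hherm 0 α, hrow 0 α, hy.1.2]
    simp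
  refine ⟨z, fun i => ?_, hval⟩
  have := (Complex.nonneg_iff.1 ((hy.1.1.2 i).diag 0)).1
  rw [hval] at this
  simpa [momEntry, peval, mul_assoc] using this

end cone

lemma continuous_mpow {n : ℕ} (α : MIdx n) : Continuous fun z : Fin n → ℂ => mpow z α := by
  unfold mpow
  fun_prop

/-- the monomial function -/
def monoF {n : ℕ} (α β : MIdx n) (z : Fin n → ℂ) : ℂ :=
  (starRingEnd ℂ) (mpow z α) * mpow z β

lemma continuous_monoF {n : ℕ} (α β : MIdx n) : Continuous (monoF α β) :=
  (Complex.continuous_conj.comp (continuous_mpow α)).mul (continuous_mpow β)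

lemma integrable_K {n : ℕ} {K : Set (Fin n → ℂ)} (hK : IsCompact K) (μ : Measure (Fin n → ℂ))
    [IsFiniteMeasure μ] (hμ : μ Kᶜ = 0) {f : (Fin n → ℂ) → ℂ} (hf : Continuous f) :
    Integrable f μ := by
  obtain ⟨C, hC⟩ := hK.exists_bound_of_continuousOn hf.continuousOn
  refine Integrable.of_bound hf.aestronglyMeasurable C ?_
  have : ∀ᵐ z ∂μ, z ∈ K := by
    rw [ae_iff]
    exact hμ
  filter_upwards [this] with z hz using hC z hz

lemma PK_of_integral {n : ℕ} {K : Set (Fin n → ℂ)} (hK : IsCompact K) (μ : Measure (Fin n → ℂ))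
    [IsFiniteMeasure μ] (hμ : μ Kᶜ = 0) {G : (Fin n → ℂ) → ℝ} (hG : Continuous G)
    (hpos : ∀ z ∈ K, 0 ≤ G z) : PK fun α β => ∫ z, (G z : ℂ) * monoF α β z ∂μ := by
  have hGc : Continuous fun z => (G z : ℂ) := Complex.continuous_ofReal.comp hG
  refine ⟨fun α β => ?_, fun ι _ a c => ?_⟩
  · rw [← integral_conj]
    congr 1
    funext z
    simp only [monoF, map_mul, Complex.conj_conj, Complex.conj_ofReal]
    ring
  · have hint : ∀ k l, Integrable
        (fun z => (starRingEnd ℂ) (c k) * ((G z : ℂ) * monoF (a k) (a l) z) * c l) μ := fun k l =>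
      integrable_K hK μ hμ ((continuous_const.mul (hGc.mul (continuous_monoF _ _))).mul
        continuous_const)
    have e : ∑ k, ∑ l, (starRingEnd ℂ) (c k) * (∫ z, (G z : ℂ) * monoF (a k) (a l) z ∂μ) * c l =
        ∫ z, ((G z * Complex.normSq (∑ l, c l * mpow z (a l)) : ℝ) : ℂ) ∂μ := by
      have e1 : ∀ k l, (starRingEnd ℂ) (c k) * (∫ z, (G z : ℂ) * monoF (a k) (a l) z ∂μ) * c l =
          ∫ z, (starRingEnd ℂ) (c k) * ((G z : ℂ) * monoF (a k) (a l) z) * c l ∂μ := fun k l => by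
        rw [integral_mul_const, integral_const_mul]
      simp only [e1]
      rw [Finset.sum_congr rfl fun k _ => (integral_finset_sum Finset.univ
        fun l _ => hint k l).symm]
      rw [← integral_finset_sum Finset.univ
        fun k _ => integrable_finset_sum Finset.univ fun l _ => hint k l]
      congr 1
      funext z
      push_cast
      rw [Complex.normSq_eq_conj_mul_self, map_sum, Finset.sum_mul_sum, Finset.mul_sum]
      refine Finset.sum_congr rfl fun k _ => ?_
      rw [Finset.mul_sum]
      refine Finset.sum_congr rfl fun l _ => ?_
      simp [monoF]
      ring
    rw [e, integral_complex_ofReal]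
    have : 0 ≤ ∫ z, G z * Complex.normSq (∑ l, c l * mpow z (a l)) ∂μ := by
      apply integral_nonneg_of_ae
      have : ∀ᵐ z ∂μ, z ∈ K := by
        rw [ae_iff]
        exact hμ
      filter_upwards [this] with z hz using mul_nonneg (hpos z hz) (Complex.normSq_nonneg _)
    exact_mod_cast this

lemma peval_complex {n l : ℕ} {φ : MIdx n → MIdx n → ℂ} (hφ : IsPolyDeg l φ) (z : Fin n → ℂ) :
    (peval φ z : ℂ) = ∑ γ ∈ degSet n l, ∑ δ ∈ degSet n l, φ γ δ * monoF γ δ z := by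
  have h : peval φ z = (∑ γ ∈ degSet n l, ∑ δ ∈ degSet n l, φ γ δ * monoF γ δ z).re := by
    rw [← finsum2_eq hφ.1]
    simp [peval, monoF, mul_assoc]
  rw [h]
  apply Complex.conj_eq_iff_re.1
  rw [map_sum]
  simp only [map_sum]
  rw [Finset.sum_comm]
  refine Finset.sum_congr rfl fun k _ => Finset.sum_congr rfl fun l _ => ?_
  simp only [monoF, map_mul, Complex.conj_conj, hφ.2]
  ring

lemma continuous_peval {n l : ℕ} {φ : MIdx n → MIdx n → ℂ} (hφ : IsPolyDeg l φ) :
    Continuous (peval φ) := by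
  have : peval φ = fun z => (∑ γ ∈ degSet n l, ∑ δ ∈ degSet n l, φ γ δ * monoF γ δ z).re := by
    funext z
    rw [← peval_complex hφ]
    simp
  rw [this]
  refine Complex.continuous_re.comp (continuous_finsetSum _ fun γ _ =>
    continuous_finsetSum _ fun δ _ => continuous_const.mul (continuous_monoF _ _))

lemma forward {n m : ℕ} {g : Fin m → MIdx n → MIdx n → ℂ} {kk : Fin m → ℕ}
    (hg : ∀ i, IsPolyDeg (kk i) (g i)) (hK : IsCompact (Kset g)) (μ : Measure (Fin n → ℂ))
    [IsFiniteMeasure μ] (hμ : μ (Kset g)ᶜ = 0) :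
    Pc g (fun α β => ∫ z, monoF α β z ∂μ) := by
  constructor
  · simpa using PK_of_integral hK μ hμ (G := fun _ => 1) continuous_const (fun _ _ => zero_le_one)
  · intro i
    have := PK_of_integral hK μ hμ (continuous_peval (hg i)) (fun z hz => hz i)
    convert this using 1
    funext α β
    rw [momEntry_eq (hg i).1]
    have hint : ∀ γ δ, Integrable (fun z => g i γ δ * monoF (α + γ) (β + δ) z) μ := fun γ δ =>
      integrable_K hK μ hμ (continuous_const.mul (continuous_monoF _ _))
    simp only [← integral_const_mul]
    rw [Finset.sum_congr rfl fun k _ => (integral_finset_sum _ fun l _ => hint k l).symm]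
    rw [← integral_finset_sum _ fun k _ => integrable_finset_sum _ fun l _ => hint k l]
    congr 1
    funext z
    rw [peval_complex (hg i), Finset.sum_mul]
    refine Finset.sum_congr rfl fun k _ => ?_
    rw [Finset.sum_mul]
    refine Finset.sum_congr rfl fun l _ => ?_
    simp [monoF, mpow_add]
    ring

/-- moments of a probability measure on `K` -/
def momOf {n : ℕ} {K : Set (Fin n → ℂ)} (μ : ProbabilityMeasure K) : MIdx n → MIdx n → ℂ :=
  fun α β => ∫ z : K, monoF α β z ∂(μ : Measure K)

lemma continuous_momOf {n : ℕ} {K : Set (Fin n → ℂ)} [CompactSpace K] :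
    Continuous (momOf (K := K)) := by
  refine continuous_pi fun α => continuous_pi fun β => ?_
  rw [continuous_iff_continuousAt]
  intro μ
  exact (ProbabilityMeasure.tendsto_iff_forall_integral_rclike_tendsto ℂ).1 tendsto_id
    (BoundedContinuousFunction.mkOfCompact
      ⟨fun z : K => monoF α β z, (continuous_monoF α β).comp continuous_subtype_val⟩)

lemma integrable_sub {n : ℕ} {K : Set (Fin n → ℂ)} [CompactSpace K] (μ : Measure K)
    [IsFiniteMeasure μ] (α β : MIdx n) : Integrable (fun z : K => monoF α β z) μ :=
  (BoundedContinuousFunction.mkOfCompact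
      ⟨fun z : K => monoF α β z, (continuous_monoF α β).comp continuous_subtype_val⟩).integrable μ

lemma convex_momOf {n : ℕ} {K : Set (Fin n → ℂ)} [CompactSpace K] :
    Convex ℝ (Set.range (momOf (K := K))) := by
  rintro _ ⟨μ, rfl⟩ _ ⟨ν, rfl⟩ a b ha hb hab
  have hp : IsProbabilityMeasure
      (ENNReal.ofReal a • (μ : Measure K) + ENNReal.ofReal b • (ν : Measure K)) := by
    constructor
    simp [← ENNReal.ofReal_add ha hb, hab]
  refine ⟨⟨_, hp⟩, ?_⟩
  funext α β
  simp only [momOf, ProbabilityMeasure.coe_mk, Pi.add_apply, Pi.smul_apply]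
  rw [integral_add_measure ((integrable_sub _ α β).smul_measure ENNReal.ofReal_ne_top)
    ((integrable_sub _ α β).smul_measure ENNReal.ofReal_ne_top), integral_smul_measure,
    integral_smul_measure, ENNReal.toReal_ofReal ha, ENNReal.toReal_ofReal hb]

lemma Cset_sub {n m : ℕ} {g : Fin m → MIdx n → MIdx n → ℂ} {kk : Fin m → ℕ} {R : ℝ}
    (hg : ∀ i, IsPolyDeg (kk i) (g i)) (hs : SphereAssumption n m g R)
    (hK : IsCompact (Kset g)) :
    Cset g ⊆ Set.range (momOf (K := Kset g)) := by
  have : CompactSpace (Kset g) := isCompact_iff_compactSpace.1 hK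
  have hcl : IsClosed (Set.range (momOf (K := Kset g))) :=
    (isCompact_range continuous_momOf).isClosed
  rw [← closure_convexHull_extremePoints (Cset_compact hg hs) (Cset_convex hg)]
  refine closure_minimal (convexHull_min ?_ convex_momOf) hcl
  intro y hy
  obtain ⟨z, hz, rfl⟩ := extreme_eval hg hs hy
  refine ⟨⟨Measure.dirac ⟨z, hz⟩, inferInstance⟩, ?_⟩
  funext α β
  simp [momOf, monoF]

lemma backward {n m : ℕ} {g : Fin m → MIdx n → MIdx n → ℂ} {kk : Fin m → ℕ} {R : ℝ}
    (hg : ∀ i, IsPolyDeg (kk i) (g i)) (hs : SphereAssumption n m g R)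
    (hK : IsCompact (Kset g)) {y : MIdx n → MIdx n → ℂ} (hy : Pc g y) :
    ∃ μ : Measure (Fin n → ℂ), IsFiniteMeasure μ ∧ μ (Kset g)ᶜ = 0 ∧
      ∀ α β : MIdx n, y α β = ∫ z, monoF α β z ∂μ := by
  have h0 := (Complex.nonneg_iff.1 (hy.1.diag 0)).1
  rcases h0.eq_or_lt with h | h
  · refine ⟨0, inferInstance, by simp, fun α β => ?_⟩
    simp [hy.eq_zero hs h.symm]
  · set t := (y 0 0).re with ht
    have hmem : t⁻¹ • y ∈ Cset g := by
      refine ⟨hy.smul hg (inv_nonneg.2 h.le), ?_⟩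
      have : (t : ℂ) ≠ 0 := by exact_mod_cast h.ne'
      rw [Pi.smul_apply, Pi.smul_apply, Complex.real_smul]
      conv_lhs => rw [hy.ofReal]
      rw [← ht]
      simp [this]
    obtain ⟨μ, hμ⟩ := Cset_sub hg hs hK hmem
    have hms : MeasurableSet (Kset g) := hK.isClosed.measurableSet
    refine ⟨ENNReal.ofReal t • (μ : Measure (Kset g)).map Subtype.val, ?_, ?_, fun α β => ?_⟩
    · exact Measure.smul_finite _ ENNReal.ofReal_ne_top
    · rw [Measure.smul_apply, Measure.map_apply measurable_subtype_coe hms.compl]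
      have : (Subtype.val : Kset g → _) ⁻¹' (Kset g)ᶜ = ∅ := by
        ext z
        simp
      simp [this]
    · rw [integral_smul_measure, ENNReal.toReal_ofReal h.le,
        integral_map measurable_subtype_coe.aemeasurable
          (continuous_monoF α β).aestronglyMeasurable]
      have : momOf μ α β = (t⁻¹ • y) α β := by rw [hμ]
      unfold momOf at this
      rw [this, Pi.smul_apply, Pi.smul_apply, smul_smul, mul_inv_cancel₀ h.ne', one_smul]


/-- (Putinar–Scheiderer.) Under the sphere assumption, an infinite hermitian array `y`
has a representing measure on `K` if and only if all the moment and localizing matrices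
`M_d(g_i y)` are positive semidefinite. -/
theorem stmt10 (n m : ℕ) (g : Fin m → MIdx n → MIdx n → ℂ) (kk : Fin m → ℕ)
    (hg : ∀ i, IsPolyDeg (kk i) (g i))
    (hK : IsCompact (Kset g))
    (R : ℝ) (hsphere : SphereAssumption n m g R)
    (y : MIdx n → MIdx n → ℂ)
    (hy : ∀ α β, (starRingEnd ℂ) (y α β) = y β α) :
    (∃ μ : Measure (Fin n → ℂ), IsFiniteMeasure μ ∧ μ (Kset g)ᶜ = 0 ∧
      ∀ α β : MIdx n, y α β = ∫ z, (starRingEnd ℂ) (mpow z α) * mpow z β ∂μ) ↔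
    (∀ d : ℕ, (momMatrixId n d y).PosSemidef ∧
      ∀ i, (momMatrix n d (g i) y).PosSemidef) := by
  rw [← Pc_iff]
  constructor
  · rintro ⟨μ, hfin, hμ, h⟩
    have := forward hg hK μ hμ
    convert this using 1
    funext α β
    exact h α β
  · intro h
    exact backward hg hsphere hK h
end
end
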